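/- (Hale–Onuchic, Theorem 2.) Consider the quasi-linear differential equation u^{(k+r+1)}(t) + Σ_{j=1}^{k+r+1} f_j(t, u(t), u'(t), …, u^{(k+r)}(t)) · u^{(k+r+1−j)}(t) = 0 for t ≥ 1, where k ≥ 0, r ≥ 0, k + r ≥ 1, and each f_j : [1,∞) × ℝ^{k+r+1} → ℝ is continuous. Suppose |f_j(t, u₀, u₁, …, u_{k+r})| ≤ h_j(t)·L_j(|u₀|, |u₁|, …, |u_{k+r}|) for all arguments, where each h_j : [1,∞) → [0,∞) is continuous, each L_j : [0,∞)^{k+r+1} → [0,∞) is continuous and nondecreasing in every argument, and ∫_1^∞ t^{j−1}·h_j(t)·L_j(β·t^k, β·t^{k−1}, …, β·t^{−r}) dt < +∞ for every β > 0 and every 1 ≤ j ≤ k+r+1. Then, for any reals c and a₁,…,a_k, there exist t₀ ≥ 1 and a (k+r+1)-times differentiable solution u : [t₀,∞) → ℝ of the equation such that u^{(i)}(t₀) = a_{k−i} for 0 ≤ i ≤ k−1 (when k ≥ 1), lim_{t→∞} u^{(k)}(t) = c, and lim_{t→∞} t^j·u^{(k+j)}(t) = 0 for 1 ≤ j ≤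 r (when r ≥ 1). -/

import Mathlib

open Real MeasureTheory Filter Topology Set Asymptotics

theorem ContinuousLinearMap.det_one_add_pos {E : Type*} [NormedAddCommGroup E] [NormedSpace ℝ E]
    [FiniteDimensional ℝ E] {A : E →L[ℝ] E} (hA : ‖A‖ < 1) : 0 < (1 + A).det := by
  have hcont : Continuous fun s : ℝ => (1 + s • A).det :=
    ContinuousLinearMap.continuous_det.comp (by fun_prop)
  have hne : ∀ s ∈ Icc (0 : ℝ) 1, (1 + s • A).det ≠ 0 := by
    intro s hs
    have hn : ‖-(s • A)‖ < 1 := by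
      rw [norm_neg, norm_smul, Real.norm_of_nonneg hs.1]
      exact lt_of_le_of_lt (mul_le_of_le_one_left (norm_nonneg _) hs.2) hA
    have := FiniteDimensional.complete ℝ E
    have hu : IsUnit (1 + s • A) := by simpa using isUnit_one_sub_of_norm_lt_one hn
    have := (hu.map ((ContinuousLinearMap.toLinearMapRingHom : (E →L[ℝ] E) →+* (E →ₗ[ℝ] E))))
    exact ((LinearMap.isUnit_iff_isUnit_det _).1 this).ne_zero
  by_contra hle
  push Not at hle
  have h0 : (1 + (0 : ℝ) • A).det = 1 := by
    simp [ContinuousLinearMap.det, ContinuousLinearMap.one_def]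
  have := intermediate_value_Icc' (zero_le_one (α := ℝ)) hcont.continuousOn
  obtain ⟨s, hs, hs0⟩ := this (show (0 : ℝ) ∈ Icc _ _ from ⟨by simpa using hle, by rw [h0]; simp⟩)
  exact hne s hs hs0

theorem ContinuousLinearMap.exists_polynomial_det_one_add_smul {E : Type*} [NormedAddCommGroup E]
    [NormedSpace ℝ E] [FiniteDimensional ℝ E] (A : E →L[ℝ] E) :
    ∃ p : Polynomial ℝ, p.natDegree ≤ Module.finrank ℝ E ∧
      ∀ t : ℝ, p.eval t = (1 + t • A).det := by
  let b := Module.finBasis ℝ E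
  let M := LinearMap.toMatrix b b (A : E →ₗ[ℝ] E)
  refine ⟨_, by simpa using Polynomial.natDegree_det_X_add_C_le M 1, fun t => ?_⟩
  rw [ContinuousLinearMap.det, ← LinearMap.det_toMatrix b, ← Polynomial.coe_evalRingHom,
    RingHom.map_det]
  congr 1
  ext i j
  by_cases hij : i = j <;>
    simp [M, LinearMap.toMatrix_apply, hij, add_comm, mul_comm t]

theorem integral_det_one_add_smul_eq {E : Type*} [NormedAddCommGroup E] [NormedSpace ℝ E]
    [FiniteDimensional ℝ E] [MeasurableSpace E] {μ : Measure E} {s : Set E}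
    {A : E → E →L[ℝ] E} {δ V : ℝ} (hδ : 0 < δ)
    (hint : ∀ t : ℝ, IntegrableOn (fun x => (1 + t • A x).det) s μ)
    (hV : ∀ t ∈ Ioo 0 δ, ∫ x in s, (1 + t • A x).det ∂μ = V) :
    ∫ x in s, (1 + A x).det ∂μ = V := by
  set n := Module.finrank ℝ E
  obtain ⟨T, hTs, hTc⟩ := (Ioo_infinite hδ).exists_subset_card_eq (n + 1)
  have key : ∀ x, (1 + A x).det =
      ∑ i ∈ T, (Lagrange.basis T id i).eval 1 * (1 + i • A x).det := by
    intro x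
    obtain ⟨p, hp, hpe⟩ := (A x).exists_polynomial_det_one_add_smul
    have hdeg : p.degree < T.card := by
      rw [hTc]
      exact lt_of_le_of_lt p.degree_le_natDegree (by exact_mod_cast Nat.lt_succ_of_le hp)
    have h1 := Lagrange.eq_interpolate (v := id) (injOn_id _) hdeg
    have h2 := congrArg (Polynomial.eval 1) h1
    rw [hpe 1, one_smul, Lagrange.interpolate_apply, Polynomial.eval_finsetSum] at h2
    rw [h2]
    refine Finset.sum_congr rfl fun i _ => ?_
    simp [hpe, mul_comm]
  have hsum : ∑ i ∈ T, (Lagrange.basis T id i).eval (1 : ℝ) = 1 := by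
    rw [← Polynomial.eval_finsetSum, Lagrange.sum_basis (injOn_id _)
      (Finset.card_pos.1 (by omega)), Polynomial.eval_one]
  simp_rw [key]
  rw [integral_finsetSum _ fun i _ => (hint i).const_mul _]
  simp_rw [integral_const_mul]
  rw [Finset.sum_congr rfl fun i hi => by rw [hV i (hTs hi)], ← Finset.sum_mul, hsum, one_mul]

open Metric in
/-- A `C¹` map of a closed ball cannot map the ball into its sphere and fix the sphere. -/
theorem not_contDiff_retraction_sphere {E : Type*} [NormedAddCommGroup E] [InnerProductSpace ℝ E]
    [FiniteDimensional ℝ E] {R : ℝ} (hR : 0 < R) {f : E → E} (hf : ContDiff ℝ 1 f)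
    (hmaps : ∀ x, ‖f x‖ = R) (hfix : ∀ x, ‖x‖ = R → f x = x) : False := by
  borelize E
  let μ : Measure E := Measure.addHaar
  let B := closedBall (0 : E) R
  let g : E → E := fun x => f x - x
  have hg : ContDiff ℝ 1 g := hf.sub contDiff_id
  have hgd : Differentiable ℝ g := hg.differentiable one_ne_zero
  let A := fderiv ℝ g
  have hA : Continuous A := hg.continuous_fderiv one_ne_zero
  have hcomp : IsCompact B := isCompact_closedBall _ _
  obtain ⟨C, hC⟩ := hcomp.exists_bound_of_continuousOn hA.continuousOn
  set K : NNReal := ⟨max C 1, by positivity⟩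
  have hK1 : (1 : ℝ) ≤ K := le_max_right _ _
  have hKA : ∀ x ∈ B, ‖A x‖ ≤ K := fun x hx => (hC x hx).trans (le_max_left _ _)
  have hlip : LipschitzOnWith K g B :=
    (convex_closedBall _ _).lipschitzOnWith_of_nnnorm_fderiv_le (fun x _ => hgd x) hKA
  have hK0 : (0 : ℝ) < K := lt_of_lt_of_le one_pos hK1
  have himage : ∀ t ∈ Ioo (0 : ℝ) (K : ℝ)⁻¹,
      InjOn (fun x => x + t • g x) B ∧ (fun x => x + t • g x) '' B = B := by
    intro t ht
    have htK : t * K < 1 := by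
      have := mul_lt_mul_of_pos_right ht.2 hK0
      rwa [inv_mul_cancel₀ hK0.ne'] at this
    have ht1 : t < 1 := lt_of_le_of_lt (le_mul_of_one_le_right ht.1.le hK1) htK
    have happ : ApproximatesLinearOn (fun x => x + t • g x)
        ((ContinuousLinearEquiv.refl ℝ E : E ≃L[ℝ] E) : E →L[ℝ] E) B (t.toNNReal * K) := by
      intro x hx y hy
      have h1 := hlip.norm_sub_le hx hy
      have h2 : x + t • g x - (y + t • g y) - (x - y) = t • (g x - g y) := by module
      simp only [ContinuousLinearEquiv.coe_refl, ContinuousLinearMap.coe_id', id]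
      rw [h2, norm_smul, Real.norm_of_nonneg ht.1.le]
      rw [NNReal.coe_mul, Real.coe_toNNReal _ ht.1.le, mul_assoc]
      exact mul_le_mul_of_nonneg_left h1 ht.1.le
    have hc : Subsingleton E ∨ (t.toNNReal * K : NNReal) <
        ‖((ContinuousLinearEquiv.refl ℝ E : E ≃L[ℝ] E).symm : E →L[ℝ] E)‖₊⁻¹ := by
      rcases subsingleton_or_nontrivial E with h | h
      · exact Or.inl h
      · right
        rw [← NNReal.coe_lt_coe]
        simpa [ht.1.le] using htK
    refine ⟨happ.injOn hc, ?_⟩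
    have hopen : IsOpen ((fun x => x + t • g x) '' ball 0 R) :=
      ((happ.mono_set ball_subset_closedBall).toOpenPartialHomeomorph _ _ hc
        isOpen_ball).open_target
    have hcontt : Continuous fun x => x + t • g x := by fun_prop
    have hsph : ∀ x, ‖x‖ = R → x + t • g x = x := fun x hx => by simp [g, hfix x hx]
    have hconv : ∀ x, x + t • g x = (1 - t) • x + t • f x := fun x => by
      simp only [g]; module
    apply Subset.antisymm
    · rintro _ ⟨x, hx, rfl⟩
      have hx' : ‖x‖ ≤ R := by simpa [B] using hx
      simp only [B, mem_closedBall_zero_iff, hconv]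
      calc ‖(1 - t) • x + t • f x‖ ≤ (1 - t) * ‖x‖ + t * ‖f x‖ := by
            refine (norm_add_le _ _).trans (le_of_eq ?_)
            rw [norm_smul, norm_smul, Real.norm_of_nonneg ht.1.le,
              Real.norm_of_nonneg (sub_nonneg.2 ht1.le)]
        _ ≤ R := by rw [hmaps]; nlinarith
    · have hball : ball (0 : E) R ⊆ (fun x => x + t • g x) '' ball 0 R := by
        refine (convex_ball (0 : E) R).isPreconnected.subset_of_closure_inter_subset hopen
          ⟨t • f 0, ?_, 0, mem_ball_self hR, by simp [g]⟩ ?_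
        · rw [mem_ball_zero_iff, norm_smul, hmaps, Real.norm_of_nonneg ht.1.le]
          nlinarith
        · rintro y ⟨hy, hyb⟩
          have hcl : closure ((fun x => x + t • g x) '' ball 0 R) ⊆ (fun x => x + t • g x) '' B :=
            closure_minimal (image_mono ball_subset_closedBall)
              (hcomp.image hcontt).isClosed
          obtain ⟨x, hx, rfl⟩ := hcl hy
          have hx' : ‖x‖ ≤ R := by simpa [B] using hx
          rcases hx'.lt_or_eq with h | h
          · exact ⟨x, by simpa using h, rfl⟩
          · have : ‖x‖ < R := by simpa [hsph x h] using hyb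
            exact absurd h this.ne
      intro y hy
      have hy' : ‖y‖ ≤ R := by simpa [B] using hy
      rcases hy'.lt_or_eq with h | h
      · exact image_mono ball_subset_closedBall (hball (by simpa using h))
      · exact ⟨y, hy, hsph y h⟩
  have hdet_cont : ∀ t : ℝ, Continuous fun x => (1 + t • A x).det := fun t =>
    ContinuousLinearMap.continuous_det.comp (by fun_prop)
  have hvol : ∀ t ∈ Ioo (0 : ℝ) (K : ℝ)⁻¹, ∫ x in B, (1 + t • A x).det ∂μ = μ.real B := by
    intro t ht
    obtain ⟨hinj, him⟩ := himage t ht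
    have hder : ∀ x ∈ B, HasFDerivWithinAt (fun x => x + t • g x) (1 + t • A x) B x :=
      fun x _ => ((hasFDerivAt_id x).add ((hgd x).hasFDerivAt.const_smul t)).hasFDerivWithinAt
    have h := integral_image_eq_integral_abs_det_fderiv_smul μ hcomp.measurableSet hder hinj
      (fun _ => (1 : ℝ))
    rw [him] at h
    simp only [smul_eq_mul, mul_one, integral_const, measureReal_restrict_apply_univ] at h
    rw [h]
    refine setIntegral_congr_fun hcomp.measurableSet fun x hx => ?_
    refine (abs_of_pos (ContinuousLinearMap.det_one_add_pos ?_)).symm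
    rw [norm_smul, Real.norm_of_nonneg ht.1.le]
    calc t * ‖A x‖ ≤ t * K := mul_le_mul_of_nonneg_left (hKA x hx) ht.1.le
      _ < (K : ℝ)⁻¹ * K := mul_lt_mul_of_pos_right ht.2 hK0
      _ = 1 := inv_mul_cancel₀ hK0.ne'
  have hfinal := integral_det_one_add_smul_eq (inv_pos.2 hK0)
    (fun t => (hdet_cont t).continuousOn.integrableOn_compact hcomp) hvol
  have hzero : ∀ x, (1 + A x).det = 0 := by
    intro x
    have hfd : HasFDerivAt f (1 + A x) x := by
      have := (hasFDerivAt_id x).add (hgd x).hasFDerivAt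
      refine this.congr_of_eventuallyEq (Eventually.of_forall fun y => ?_)
      simp [g]
    have hns : HasFDerivAt (fun y => ‖f y‖ ^ 2) (0 : E →L[ℝ] ℝ) x := by
      simp only [hmaps]; exact hasFDerivAt_const _ _
    have heq := hns.unique hfd.norm_sq
    have horth : ∀ v, inner ℝ (f x) ((1 + A x) v) = 0 := by
      intro v
      have := congrArg (fun l : E →L[ℝ] ℝ => l v) heq
      have h2 : 2 * inner ℝ (f x) ((1 + A x) v) = 0 := by
        simpa [inner_add_right, mul_add] using this.symm
      linarith
    by_contra hne
    have hu : IsUnit ((1 + A x : E →L[ℝ] E) : E →ₗ[ℝ] E) :=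
      (LinearMap.isUnit_iff_isUnit_det _).2 (Ne.isUnit hne)
    obtain ⟨v, hv⟩ := ((Module.End.isUnit_iff _).1 hu).2 (f x)
    have h0 := horth v
    have hv' : (1 + A x) v = f x := hv
    rw [hv', real_inner_self_eq_norm_sq, hmaps] at h0
    exact hR.ne' (by simpa using h0)
  simp only [hzero, integral_zero] at hfinal
  have hpos : 0 < μ.real B :=
    ENNReal.toReal_pos (measure_closedBall_pos μ 0 hR).ne' hcomp.measure_ne_top
  exact hpos.ne hfinal

/-- **Brouwer's fixed point theorem** for bounded self-maps of a Euclidean space. -/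
theorem exists_fixedPoint_of_norm_le {E : Type*} [NormedAddCommGroup E] [InnerProductSpace ℝ E]
    [FiniteDimensional ℝ E] {H : E → E} (hH : Continuous H) {M : ℝ} (hM : ∀ x, ‖H x‖ ≤ M) :
    ∃ x, H x = x := by
  by_contra! hne
  have hM0 : 0 ≤ M := (norm_nonneg _).trans (hM 0)
  let R : ℝ := M + 2
  have hcont : Continuous fun x => ‖H x - x‖ := by fun_prop
  obtain ⟨x₀, -, hx₀⟩ := (isCompact_closedBall (0 : E) (M + 1)).exists_isMinOn
    ⟨0, by simp; linarith⟩ hcont.continuousOn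
  have hpos : 0 < ‖H x₀ - x₀‖ := norm_pos_iff.2 (sub_ne_zero.2 (hne x₀))
  obtain ⟨P, hP, hPH, -⟩ := hH.exists_contDiff_approx 1
    (continuous_const (y := min 1 ‖H x₀ - x₀‖)) (fun _ => lt_min one_pos hpos)
  have hPM : ∀ x, ‖P x‖ < M + 1 := fun x => by
    have h1 := (hPH x).trans_le (min_le_left _ _)
    rw [dist_eq_norm] at h1
    have h2 := norm_le_norm_add_norm_sub' (P x) (H x)
    linarith [hM x]
  let χ : ContDiffBump (0 : E) := ⟨M + 1, M + 2, by linarith, by linarith⟩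
  let F : E → E := fun x => x - χ x • P x
  have hF : ContDiff ℝ 1 F := contDiff_id.sub (χ.contDiff.smul hP)
  have hF0 : ∀ x, F x ≠ 0 := by
    intro x h0
    have hx : x = χ x • P x := sub_eq_zero.1 h0
    rcases le_or_gt ‖x‖ (M + 1) with h | h
    · have h1 : χ x = 1 := χ.one_of_mem_closedBall (by simpa using h)
      rw [h1, one_smul] at hx
      have h2 := (hPH x).trans_le (min_le_right _ _)
      rw [← hx, dist_comm, dist_eq_norm] at h2
      exact absurd (hx₀ (by simpa using h : x ∈ Metric.closedBall (0 : E) (M + 1))) (not_le.2 h2)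
    · have h1 : ‖χ x • P x‖ ≤ ‖P x‖ := by
        rw [norm_smul, Real.norm_of_nonneg χ.nonneg]
        exact mul_le_of_le_one_left (norm_nonneg _) χ.le_one
      rw [← hx] at h1
      linarith [hPM x]
  have hRpos : 0 < R := by simp only [R]; linarith
  refine not_contDiff_retraction_sphere hRpos (f := fun x => (R / ‖F x‖) • F x) ?_ ?_ ?_
  · exact (contDiff_const.div (hF.norm ℝ hF0) fun x => norm_ne_zero_iff.2 (hF0 x)).smul hF
  · intro x
    rw [norm_smul, norm_div, norm_norm, div_mul_cancel₀ _ (norm_ne_zero_iff.2 (hF0 x)),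
      Real.norm_of_nonneg hRpos.le]
  · intro x hx
    have h1 : χ x = 0 := χ.zero_of_le_dist (by simpa [χ, R] using hx.ge)
    simp [F, h1, hx, hRpos.ne']

/-- Discretisation: nodal values on a finite net are found by Brouwer's theorem. -/
theorem exists_approx_fixedPoint {ι : Type*} [Fintype ι]
    {T : C(ℝ, ι → ℝ) → C(ℝ, ι → ℝ)} {B E : ℝ → ℝ}
    (hB : ∀ v t, ‖T v t‖ ≤ B t) (hTE : ∀ v s t, ‖T v s - T v t‖ ≤ |E s - E t|)
    (hT : ∀ (x : ℕ → C(ℝ, ι → ℝ)) (v : C(ℝ, ι → ℝ)),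
      (∀ t, Tendsto (fun n => x n t) atTop (𝓝 (v t))) →
      ∀ t, Tendsto (fun n => T (x n) t) atTop (𝓝 (T v t)))
    {ε : ℝ} (hε : 0 < ε) (b : ℝ) :
    ∃ v : C(ℝ, ι → ℝ), ∀ t ∈ Icc (-b) b, ∀ η, (∀ s, |t - s| < 2 * ε → |E s - E t| ≤ η) →
      ‖v t - T v t‖ ≤ η := by
  classical
  obtain ⟨S, -, hSfin, hS⟩ := (isCompact_Icc (a := -b) (b := b)).finite_cover_balls hε
  have := hSfin.fintype
  let φ : S → ℝ → ℝ := fun s t => max 0 (2 * ε - |t - s|)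
  let m : ℝ → ℝ := fun t => max ε (∑ s, φ s t)
  have hm : ∀ t, 0 < m t := fun t => lt_max_of_lt_left hε
  have hφ : ∀ s, Continuous (φ s) := fun s => by fun_prop
  have hmc : Continuous m := by fun_prop
  let W : EuclideanSpace ℝ (S × ι) → C(ℝ, ι → ℝ) := fun z =>
    ⟨fun t i => ∑ s, φ s t / m t * z (s, i), continuous_pi fun i =>
      continuous_finsetSum _ fun s _ => (((hφ s).div hmc fun t => (hm t).ne').mul continuous_const)⟩
  let H : EuclideanSpace ℝ (S × ι) → EuclideanSpace ℝ (S × ι) := fun z =>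
    WithLp.toLp 2 fun p => T (W z) p.1 p.2
  have hH : Continuous H := by
    rw [continuous_iff_seqContinuous]
    intro z z₀ hz
    have hz' : ∀ p, Tendsto (fun n => z n p) atTop (𝓝 (z₀ p)) := fun p =>
      ((EuclideanSpace.proj (𝕜 := ℝ) p).continuous.tendsto z₀).comp hz
    have hW : ∀ t, Tendsto (fun n => W (z n) t) atTop (𝓝 (W z₀ t)) := fun t =>
      tendsto_pi_nhds.2 fun i => tendsto_finsetSum _ fun s _ => (hz' (s, i)).const_mul _
    have := hT _ _ hW
    refine ((PiLp.continuous_toLp 2 _).tendsto _).comp (tendsto_pi_nhds.2 fun p => ?_)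
    exact tendsto_pi_nhds.1 (this p.1) p.2
  have hHb : ∀ z, ‖H z‖ ≤ √(∑ p : S × ι, B p.1 ^ 2) := by
    intro z
    rw [EuclideanSpace.norm_eq]
    refine Real.sqrt_le_sqrt (Finset.sum_le_sum fun p _ => ?_)
    exact pow_le_pow_left₀ (norm_nonneg _) ((norm_le_pi_norm _ p.2).trans (hB _ _)) 2
  obtain ⟨z, hz⟩ := exists_fixedPoint_of_norm_le hH hHb
  refine ⟨W z, fun t ht η hη => ?_⟩
  have hη0 : 0 ≤ η := (abs_nonneg _).trans (hη t (by simpa using hε))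
  have hzT : ∀ s i, z (s, i) = T (W z) s i := fun s i => by
    conv_lhs => rw [← hz]
  have hsum : m t = ∑ s, φ s t := by
    obtain ⟨s, hs, hts⟩ := mem_iUnion₂.1 (hS ht)
    rw [Metric.mem_ball, Real.dist_eq] at hts
    refine max_eq_right ?_
    calc ε ≤ φ ⟨s, hs⟩ t := le_max_of_le_right (by simp only; linarith)
      _ ≤ _ := Finset.single_le_sum (f := fun s => φ s t) (fun s _ => le_max_left _ _)
        (Finset.mem_univ _)
  have hw1 : ∑ s, φ s t / m t = 1 := by
    rw [← Finset.sum_div, ← hsum, div_self (hm t).ne']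
  rw [pi_norm_le_iff_of_nonneg hη0]
  intro i
  have h1 : (W z t - T (W z) t) i = ∑ s, φ s t / m t * (T (W z) s i - T (W z) t i) := by
    simp only [mul_sub, Finset.sum_sub_distrib, ← Finset.sum_mul, hw1, one_mul, Pi.sub_apply]
    exact congrArg (· - T (W z) t i)
      (Finset.sum_congr rfl fun s _ => congrArg (φ s t / m t * ·) (hzT s i))
  rw [h1]
  calc _ ≤ ∑ s, φ s t / m t * η := by
        refine (norm_sum_le _ _).trans (Finset.sum_le_sum fun s _ => ?_)
        have h0 : 0 ≤ φ s t / m t := div_nonneg (le_max_left _ _) (hm t).le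
        rw [norm_mul, Real.norm_of_nonneg h0]
        rcases le_or_gt (2 * ε) |t - s| with h | h
        · have : φ s t = 0 := max_eq_left (by linarith)
          simp [this]
        · refine mul_le_mul_of_nonneg_left ?_ h0
          exact ((norm_le_pi_norm (T (W z) s - T (W z) t) i).trans (hTE _ _ _)).trans (hη s h)
    _ = η := by rw [← Finset.sum_mul, hw1, one_mul]

/-- A Schauder-type fixed point theorem for operators on continuous functions on the line whose
range is pointwise bounded and has a common modulus of continuity. -/
theorem exists_fixedPoint_of_equicontinuous {ι : Type*} [Fintype ι]
    {T : C(ℝ, ι → ℝ) → C(ℝ, ι → ℝ)} {B E : ℝ → ℝ} (hE : Continuous E)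
    (hB : ∀ v t, ‖T v t‖ ≤ B t) (hTE : ∀ v s t, ‖T v s - T v t‖ ≤ |E s - E t|)
    (hT : ∀ (x : ℕ → C(ℝ, ι → ℝ)) (v : C(ℝ, ι → ℝ)),
      (∀ t, Tendsto (fun n => x n t) atTop (𝓝 (v t))) →
      ∀ t, Tendsto (fun n => T (x n) t) atTop (𝓝 (T v t))) :
    ∃ v, T v = v := by
  let K : Set C(ℝ, ι → ℝ) := {v | (∀ t, ‖v t‖ ≤ B t) ∧ ∀ s t, ‖v s - v t‖ ≤ |E s - E t|}
  have hequi : Equicontinuous ((↑) : K → ℝ → ι → ℝ) := by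
    intro t
    refine Metric.equicontinuousAt_of_continuity_modulus (fun s => |E t - E s|) ?_ _ ?_
    · have : ContinuousAt (fun s => |E t - E s|) t := by fun_prop
      simpa [ContinuousAt] using this
    · refine Eventually.of_forall fun s v => ?_
      rw [dist_eq_norm]
      exact v.2.2 t s
  have hKc : IsCompact K := by
    refine ArzelaAscoli.isCompact_of_equicontinuous K ?_ hequi
    have himage : ContinuousMap.toFun '' K =
        {v : ℝ → ι → ℝ | ∀ s t, ‖v s - v t‖ ≤ |E s - E t|} ∩
          univ.pi fun t => Metric.closedBall 0 (B t) := by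
      ext v
      constructor
      · rintro ⟨w, hw, rfl⟩
        exact ⟨hw.2, fun t _ => by simpa using hw.1 t⟩
      · rintro ⟨h1, h2⟩
        have hv : Continuous v := by
          rw [continuous_iff_continuousAt]
          intro t
          rw [ContinuousAt, tendsto_iff_norm_sub_tendsto_zero]
          refine squeeze_zero (fun _ => norm_nonneg _) (fun s => h1 s t) ?_
          have : ContinuousAt (fun s => |E s - E t|) t := by fun_prop
          simpa [ContinuousAt] using this
        exact ⟨⟨v, hv⟩, ⟨fun t => by simpa using h2 t (mem_univ _), h1⟩, rfl⟩
    rw [himage]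
    refine (isCompact_univ_pi fun t => isCompact_closedBall _ _).inter_left ?_
    simp only [ofPred_forall]
    exact isClosed_iInter fun s => isClosed_iInter fun t =>
      isClosed_le (by fun_prop) continuous_const
  have happrox : ∀ n : ℕ, ∃ v : C(ℝ, ι → ℝ), ∀ t ∈ Icc (-(n : ℝ)) n, ∀ η,
      (∀ s, |t - s| < 2 * (1 / ((n : ℝ) + 1)) → |E s - E t| ≤ η) → ‖v t - T v t‖ ≤ η := fun n =>
    exists_approx_fixedPoint hB hTE hT Nat.one_div_pos_of_nat n
  choose v hv using happrox
  obtain ⟨u, -, ψ, hψ, hu⟩ := hKc.tendsto_subseq (x := fun n => T (v n))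
    fun n => ⟨hB _, hTE _⟩
  have hu' : ∀ t, Tendsto (fun n => T (v (ψ n)) t) atTop (𝓝 (u t)) := fun t =>
    ((continuous_eval_const (F := C(ℝ, ι → ℝ)) t).tendsto u).comp hu
  have hdiff : ∀ t, Tendsto (fun n => v n t - T (v n) t) atTop (𝓝 0) := by
    intro t
    rw [Metric.tendsto_atTop]
    intro η hη
    obtain ⟨δ, hδ, hEδ⟩ := Metric.continuous_iff.1 hE t (η / 2) (half_pos hη)
    obtain ⟨N₁, hN₁⟩ := exists_nat_gt (2 / δ)
    obtain ⟨N₂, hN₂⟩ := exists_nat_gt |t|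
    refine ⟨max N₁ N₂, fun n hn => ?_⟩
    have h1 : (N₁ : ℝ) ≤ n := by exact_mod_cast (le_max_left _ _).trans hn
    have h2 : (N₂ : ℝ) ≤ n := by exact_mod_cast (le_max_right _ _).trans hn
    rw [dist_zero_right]
    refine lt_of_le_of_lt (hv n t (abs_le.1 (by linarith)) (η / 2) fun s hs => ?_) (half_lt_self hη)
    have hnδ : 2 * (1 / ((n : ℝ) + 1)) ≤ δ := by
      rw [mul_one_div, div_le_iff₀ (by positivity)]
      have := (div_lt_iff₀ hδ).1 (hN₁.trans_le (h1.trans (by linarith : (n : ℝ) ≤ n + 1)))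
      linarith
    have := hEδ s (by rw [Real.dist_eq, abs_sub_comm]; linarith)
    rw [Real.dist_eq] at this
    exact this.le
  have hvu : ∀ t, Tendsto (fun n => v (ψ n) t) atTop (𝓝 (u t)) := fun t => by
    simpa using ((hdiff t).comp hψ.tendsto_atTop).add (hu' t)
  exact ⟨u, ContinuousMap.ext fun t => tendsto_nhds_unique (hT _ _ hvu t) (hu' t)⟩

/-- A continuous function which is integrable at infinity against the weight `s ^ p`. -/
structure WeightIntegrable (t₀ : ℝ) (p : ℕ) (w : ℝ → ℝ) : Prop where
  continuous : Continuous w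
  integrableOn : IntegrableOn (fun s => s ^ p * w s) (Ioi t₀)

/-- The antiderivative of `w` vanishing at infinity. -/
noncomputable def tailIntegral (w : ℝ → ℝ) (t : ℝ) : ℝ := -∫ s in Ioi t, w s

theorem Continuous.integrableOn_Ioi_of_integrableOn_Ioi {w : ℝ → ℝ} {a : ℝ} (hw : Continuous w)
    (h : IntegrableOn w (Ioi a)) (b : ℝ) : IntegrableOn w (Ioi b) := by
  have h1 : IntegrableOn w (Icc b a) := hw.integrableOn_Icc
  refine (h1.union h).mono_set fun x hx => ?_
  rcases le_or_gt x a with h | h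
  · exact Or.inl ⟨le_of_lt hx, h⟩
  · exact Or.inr h

theorem hasDerivAt_integral_Ioi {w : ℝ → ℝ} {a : ℝ} (hw : Continuous w)
    (h : IntegrableOn w (Ioi a)) (t : ℝ) :
    HasDerivAt (fun t => ∫ s in Ioi t, w s) (-w t) t := by
  have heq : (fun t => ∫ s in Ioi t, w s) = fun t => (∫ s in Ioi a, w s) - ∫ s in a..t, w s := by
    ext t
    rw [← intervalIntegral.integral_Ioi_sub_Ioi' h (hw.integrableOn_Ioi_of_integrableOn_Ioi h t)]
    ring
  rw [heq]
  exact (intervalIntegral.integral_hasDerivAt_right (hw.intervalIntegrable _ _)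
    (hw.stronglyMeasurableAtFilter _ _) hw.continuousAt).const_sub _

namespace WeightIntegrable

variable {t₀ : ℝ} {p : ℕ} {w w' : ℝ → ℝ}

theorem sub (hw : WeightIntegrable t₀ p w) (hw' : WeightIntegrable t₀ p w') :
    WeightIntegrable t₀ p (fun t => w t - w' t) :=
  ⟨hw.continuous.sub hw'.continuous, by
    have h : IntegrableOn (fun s => s ^ p * w s - s ^ p * w' s) (Ioi t₀) :=
      hw.integrableOn.sub hw'.integrableOn
    simpa only [mul_sub] using h⟩

theorem abs (ht₀ : 1 ≤ t₀) (hw : WeightIntegrable t₀ p w) :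
    WeightIntegrable t₀ p (fun t => |w t|) :=
  ⟨hw.continuous.abs, by
    have h : IntegrableOn (fun s => |s ^ p * w s|) (Ioi t₀) := hw.integrableOn.abs
    refine h.congr_fun (fun s hs => ?_) measurableSet_Ioi
    have : (0 : ℝ) ≤ s := by linarith [mem_Ioi.1 hs]
    simp only [abs_mul, abs_of_nonneg (pow_nonneg this p)]⟩

theorem mono (ht₀ : 1 ≤ t₀) (hw : WeightIntegrable t₀ p w) {q : ℕ} (hqp : q ≤ p) :
    WeightIntegrable t₀ q w := by
  have hc := hw.continuous
  refine ⟨hc, Integrable.mono hw.integrableOn (by fun_prop) ?_⟩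
  refine (ae_restrict_mem measurableSet_Ioi).mono fun s hs => ?_
  have hs1 : (1 : ℝ) ≤ s := by linarith [mem_Ioi.1 hs]
  rw [norm_mul, norm_mul]
  refine mul_le_mul_of_nonneg_right ?_ (norm_nonneg _)
  rw [Real.norm_of_nonneg (by positivity), Real.norm_of_nonneg (by positivity)]
  exact pow_le_pow_right₀ hs1 hqp

theorem integrableOn_self (ht₀ : 1 ≤ t₀) (hw : WeightIntegrable t₀ p w) :
    IntegrableOn w (Ioi t₀) := by
  simpa using (hw.mono ht₀ (Nat.zero_le p)).integrableOn

theorem hasDerivAt_tailIntegral (ht₀ : 1 ≤ t₀) (hw : WeightIntegrable t₀ p w) (t : ℝ) :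
    HasDerivAt (tailIntegral w) (w t) t := by
  have h := (hasDerivAt_integral_Ioi hw.continuous (hw.integrableOn_self ht₀) t).neg
  rw [neg_neg] at h
  exact h

theorem continuous_tailIntegral (ht₀ : 1 ≤ t₀) (hw : WeightIntegrable t₀ p w) :
    Continuous (tailIntegral w) :=
  continuous_iff_continuousAt.2 fun t => (hw.hasDerivAt_tailIntegral ht₀ t).continuousAt

theorem pow_mul_integral_abs_le (ht₀ : 1 ≤ t₀) (hw : WeightIntegrable t₀ p w) {t : ℝ}
    (ht : t₀ ≤ t) : t ^ p * ∫ s in Ioi t, |w s| ≤ ∫ s in Ioi t, s ^ p * |w s| := by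
  rw [← integral_const_mul]
  have hsub := Ioi_subset_Ioi ht
  refine setIntegral_mono_on (((hw.abs ht₀).integrableOn_self ht₀).mono_set hsub |>.const_mul _)
    ((hw.abs ht₀).integrableOn.mono_set hsub) measurableSet_Ioi fun s hs => ?_
  exact mul_le_mul_of_nonneg_right (pow_le_pow_left₀ (by linarith) (le_of_lt hs) p) (abs_nonneg _)

theorem abs_tailIntegral_le (t : ℝ) : |tailIntegral w t| ≤ ∫ s in Ioi t, |w s| := by
  rw [tailIntegral, abs_neg]
  exact abs_integral_le_integral_abs

theorem pow_mul_abs_tailIntegral_le (ht₀ : 1 ≤ t₀) (hw : WeightIntegrable t₀ p w) {t : ℝ}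
    (ht : t₀ ≤ t) : t ^ p * |tailIntegral w t| ≤ ∫ s in Ioi t, s ^ p * |w s| :=
  (mul_le_mul_of_nonneg_left (abs_tailIntegral_le t)
    (pow_nonneg (by linarith) p)).trans (hw.pow_mul_integral_abs_le ht₀ ht)

/-- Taking the antiderivative vanishing at infinity costs one power of the weight. -/
theorem integrableOn_pow_mul_tailIntegral (ht₀ : 1 ≤ t₀) (hw : WeightIntegrable t₀ (p + 1) w)
    {t : ℝ} (ht : t₀ ≤ t) : IntegrableOn (fun s => s ^ p * tailIntegral w s) (Ioi t) ∧
      ∫ s in Ioi t, s ^ p * |tailIntegral w s| ≤ ∫ s in Ioi t, s ^ (p + 1) * |w s| := by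
  have hwa := hw.abs ht₀
  let A : ℝ → ℝ := fun t => ∫ s in Ioi t, |w s|
  let M : ℝ → ℝ := fun t => ∫ s in Ioi t, s ^ (p + 1) * |w s|
  have hA : ∀ x, HasDerivAt A (-|w x|) x :=
    hasDerivAt_integral_Ioi hwa.continuous (hwa.integrableOn_self ht₀)
  have hA0 : ∀ x, 0 ≤ A x := fun x => integral_nonneg fun s => abs_nonneg _
  have hM : ∀ x, HasDerivAt M (-(x ^ (p + 1) * |w x|)) x :=
    hasDerivAt_integral_Ioi ((continuous_pow _).mul hwa.continuous) hwa.integrableOn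
  have hder : ∀ x ∈ Ici t, HasDerivAt (fun x => x ^ (p + 1) * A x - M x)
      ((p + 1) * x ^ p * A x) x := by
    intro x _
    refine (((hasDerivAt_pow (p + 1) x).mul (hA x)).sub (hM x)).congr_deriv ?_
    push_cast [Nat.add_sub_cancel]
    ring
  have hpos : ∀ x ∈ Ioi t, 0 ≤ (p + 1) * x ^ p * A x := fun x hx => by
    have : 0 ≤ x := by linarith [mem_Ioi.1 hx]
    have := hA0 x
    positivity
  have hMlim : Tendsto M atTop (𝓝 0) := tendsto_integral_Ioi_zero tendsto_id
  have hAlim : Tendsto (fun x => x ^ (p + 1) * A x) atTop (𝓝 0) := by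
    refine squeeze_zero' ?_ ?_ hMlim
    · filter_upwards [eventually_ge_atTop t₀] with x hx
      have : 0 ≤ x := by linarith
      exact mul_nonneg (by positivity) (hA0 x)
    · filter_upwards [eventually_ge_atTop t₀] with x hx
      exact hw.pow_mul_integral_abs_le ht₀ hx
  have hlim := hAlim.sub hMlim
  have hint := integrableOn_Ioi_deriv_of_nonneg' hder hpos hlim
  have hval := integral_Ioi_of_hasDerivAt_of_nonneg' hder hpos hlim
  have hdom : ∀ s ∈ Ioi t, s ^ p * |tailIntegral w s| ≤ (p + 1) * s ^ p * A s := by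
    intro s hs
    have hs0 : 0 ≤ s := by linarith [mem_Ioi.1 hs]
    calc s ^ p * |tailIntegral w s| ≤ s ^ p * A s :=
          mul_le_mul_of_nonneg_left (abs_tailIntegral_le s) (by positivity)
      _ ≤ (p + 1) * (s ^ p * A s) :=
          le_mul_of_one_le_left (mul_nonneg (by positivity) (hA0 s)) (by simp)
      _ = _ := by ring
  have hc := hw.continuous_tailIntegral ht₀
  have hI : IntegrableOn (fun s => s ^ p * tailIntegral w s) (Ioi t) := by
    refine hint.mono' (by fun_prop) ?_
    refine (ae_restrict_mem measurableSet_Ioi).mono fun s hs => ?_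
    have hs0 : 0 ≤ s := by linarith [mem_Ioi.1 hs]
    rw [norm_mul, Real.norm_of_nonneg (by positivity), Real.norm_eq_abs]
    exact hdom s hs
  refine ⟨hI, ?_⟩
  calc _ ≤ ∫ s in Ioi t, (p + 1) * s ^ p * A s := by
        refine setIntegral_mono_on (hint.mono' (by fun_prop) ?_) hint measurableSet_Ioi hdom
        refine (ae_restrict_mem measurableSet_Ioi).mono fun s hs => ?_
        have hs0 : 0 ≤ s := by linarith [mem_Ioi.1 hs]
        rw [Real.norm_of_nonneg (by positivity)]
        exact hdom s hs
    _ ≤ M t := by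
        have : 0 ≤ t ^ (p + 1) * A t := mul_nonneg (pow_nonneg (by linarith) _) (hA0 t)
        rw [hval]
        linarith

theorem weightIntegrable_tailIntegral (ht₀ : 1 ≤ t₀) (hw : WeightIntegrable t₀ (p + 1) w) :
    WeightIntegrable t₀ p (tailIntegral w) :=
  ⟨hw.continuous_tailIntegral ht₀, (hw.integrableOn_pow_mul_tailIntegral ht₀ le_rfl).1⟩

theorem tailIntegral_sub (ht₀ : 1 ≤ t₀) (hw : WeightIntegrable t₀ p w)
    (hw' : WeightIntegrable t₀ p w') (t : ℝ) :
    tailIntegral (fun t => w t - w' t) t =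
      tailIntegral w t - tailIntegral w' t := by
  simp only [tailIntegral]
  rw [integral_sub
    (hw.continuous.integrableOn_Ioi_of_integrableOn_Ioi (hw.integrableOn_self ht₀) t)
    (hw'.continuous.integrableOn_Ioi_of_integrableOn_Ioi (hw'.integrableOn_self ht₀) t)]
  ring

theorem iterate_tailIntegral (ht₀ : 1 ≤ t₀) (q : ℕ) (hw : WeightIntegrable t₀ (p + q) w) :
    WeightIntegrable t₀ p (tailIntegral^[q] w) ∧ ∀ t, t₀ ≤ t →
      ∫ s in Ioi t, s ^ p * |tailIntegral^[q] w s| ≤ ∫ s in Ioi t, s ^ (p + q) * |w s| := by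
  induction q generalizing p with
  | zero => exact ⟨hw, fun t _ => le_rfl⟩
  | succ q ih =>
    have hw1 : WeightIntegrable t₀ (p + 1 + q) w := by rwa [add_right_comm]
    obtain ⟨h1, h2⟩ := ih hw1
    simp only [Function.iterate_succ_apply']
    refine ⟨h1.weightIntegrable_tailIntegral ht₀, fun t ht =>
      ((h1.integrableOn_pow_mul_tailIntegral ht₀ ht).2.trans (h2 t ht)).trans
      (le_of_eq ?_)⟩
    rw [add_right_comm, add_assoc]

theorem iterate_tailIntegral_sub (ht₀ : 1 ≤ t₀) (q : ℕ) (hw : WeightIntegrable t₀ (p + q) w)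
    (hw' : WeightIntegrable t₀ (p + q) w') (t : ℝ) :
    tailIntegral^[q + 1] (fun t => w t - w' t) t =
      tailIntegral^[q + 1] w t - tailIntegral^[q + 1] w' t := by
  induction q generalizing p t with
  | zero => exact tailIntegral_sub ht₀ hw hw' t
  | succ q ih =>
    have hw1 : WeightIntegrable t₀ (p + 1 + q) w := by rwa [add_right_comm]
    have hw1' : WeightIntegrable t₀ (p + 1 + q) w' := by rwa [add_right_comm]
    simp only [Function.iterate_succ_apply' _ (q + 1)]
    rw [funext (ih hw1 hw1')]
    exact tailIntegral_sub ht₀ (iterate_tailIntegral ht₀ (q + 1) hw).1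
      (iterate_tailIntegral ht₀ (q + 1) hw').1 t

theorem pow_mul_abs_iterate_tailIntegral_le (ht₀ : 1 ≤ t₀) (q : ℕ)
    (hw : WeightIntegrable t₀ (p + q) w) {t : ℝ} (ht : t₀ ≤ t) :
    t ^ p * |tailIntegral^[q + 1] w t| ≤ ∫ s in Ioi t, s ^ (p + q) * |w s| := by
  obtain ⟨h1, h2⟩ := iterate_tailIntegral ht₀ q hw
  rw [Function.iterate_succ_apply']
  exact (h1.pow_mul_abs_tailIntegral_le ht₀ ht).trans (h2 t ht)

end WeightIntegrable

/-- Iterated antiderivatives of `w`, the `i`-th one taking the value `a i` at `t₀`. -/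
noncomputable def headIter (t₀ : ℝ) (a : ℕ → ℝ) (w : ℝ → ℝ) : ℕ → ℝ → ℝ
  | 0 => w
  | i + 1 => fun t => a (i + 1) + ∫ s in t₀..t, headIter t₀ a w i s

section headIter

variable {t₀ : ℝ} {a : ℕ → ℝ} {w w' : ℝ → ℝ}

theorem continuous_headIter (hw : Continuous w) (i : ℕ) : Continuous (headIter t₀ a w i) := by
  induction i with
  | zero => exact hw
  | succ i ih =>
    exact continuous_const.add
      (intervalIntegral.continuous_primitive (fun _ _ => ih.intervalIntegrable _ _) t₀)

theorem hasDerivAt_headIter (hw : Continuous w) (i : ℕ) (t : ℝ) :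
    HasDerivAt (headIter t₀ a w (i + 1)) (headIter t₀ a w i t) t := by
  have hc := continuous_headIter (t₀ := t₀) (a := a) hw i
  exact (intervalIntegral.integral_hasDerivAt_right (hc.intervalIntegrable _ _)
    (hc.stronglyMeasurableAtFilter _ _) hc.continuousAt).const_add _

theorem headIter_sub (hw : Continuous w) (hw' : Continuous w') (i : ℕ) (t : ℝ) :
    headIter t₀ a w i t - headIter t₀ a w' i t =
      headIter t₀ 0 (fun s => w s - w' s) i t := by
  induction i generalizing t with
  | zero => rfl
  | succ i ih =>
    simp only [headIter, Pi.zero_apply, zero_add, add_sub_add_left_eq_sub]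
    rw [← intervalIntegral.integral_sub ((continuous_headIter hw i).intervalIntegrable _ _)
      ((continuous_headIter hw' i).intervalIntegrable _ _)]
    simp only [ih]

theorem abs_headIter_le (ht₀ : 1 ≤ t₀) {C : ℝ} (hC : ∀ s, t₀ ≤ s → |w s| ≤ C) (i : ℕ) {t : ℝ}
    (ht : t₀ ≤ t) :
    |headIter t₀ a w i t| ≤ (C + ∑ j ∈ Finset.range i, |a (j + 1)|) * t ^ i := by
  have hC0 : 0 ≤ C := (abs_nonneg _).trans (hC t₀ le_rfl)
  induction i generalizing t with
  | zero => simpa [headIter] using hC t ht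
  | succ i ih =>
    have hS : 0 ≤ C + ∑ j ∈ Finset.range i, |a (j + 1)| :=
      add_nonneg hC0 (Finset.sum_nonneg fun _ _ => abs_nonneg _)
    have ht1 : 1 ≤ t := ht₀.trans ht
    have hint : ‖∫ s in t₀..t, headIter t₀ a w i s‖ ≤
        (C + ∑ j ∈ Finset.range i, |a (j + 1)|) * t ^ i * |t - t₀| := by
      refine intervalIntegral.norm_integral_le_of_norm_le_const fun s hs => ?_
      rw [uIoc_of_le ht] at hs
      refine (ih hs.1.le).trans (mul_le_mul_of_nonneg_left ?_ hS)
      exact pow_le_pow_left₀ (by linarith [hs.1]) hs.2 i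
    have hlen : |t - t₀| ≤ t := by rw [abs_of_nonneg (by linarith)]; linarith
    have hpow : 1 ≤ t ^ (i + 1) := one_le_pow₀ ht1
    rw [Finset.sum_range_succ, headIter]
    calc _ ≤ |a (i + 1)| + ‖∫ s in t₀..t, headIter t₀ a w i s‖ := abs_add_le _ _
      _ ≤ |a (i + 1)| * t ^ (i + 1) +
          (C + ∑ j ∈ Finset.range i, |a (j + 1)|) * t ^ i * t :=
        add_le_add (le_mul_of_one_le_right (abs_nonneg _) hpow)
          (hint.trans (mul_le_mul_of_nonneg_left hlen (by positivity)))
      _ = _ := by ring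

end headIter

/-- The function with `(k + r + 1)`-st derivative `G`, prescribed by `a` at `t₀` and by `c` at
infinity, together with its successive derivatives. -/
noncomputable def derivChain (k r : ℕ) (t₀ c : ℝ) (a : ℕ → ℝ) (G : ℝ → ℝ) (m : ℕ) : ℝ → ℝ :=
  if m ≤ k then headIter t₀ a (fun t => c + tailIntegral^[r + 1] G t) (k - m)
  else tailIntegral^[k + r + 1 - m] G

section derivChain

variable {k r : ℕ} {t₀ c : ℝ} {a : ℕ → ℝ} {G G' : ℝ → ℝ}

theorem derivChain_last : derivChain k r t₀ c a G (k + r + 1) = G := by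
  rw [derivChain, if_neg (by omega), Nat.sub_self]
  rfl

theorem derivChain_apply_left {i : ℕ} (hi : i < k) :
    derivChain k r t₀ c a G i t₀ = a (k - i) := by
  obtain ⟨n, hn⟩ : ∃ n, k - i = n + 1 := ⟨k - i - 1, by omega⟩
  rw [derivChain, if_pos hi.le, hn]
  simp only [headIter, intervalIntegral.integral_same, add_zero]

theorem WeightIntegrable.hasDerivAt_iterate_tailIntegral (ht₀ : 1 ≤ t₀)
    (hG : WeightIntegrable t₀ r G) {q : ℕ} (hq : q ≤ r) (t : ℝ) :
    HasDerivAt (tailIntegral^[q + 1] G) (tailIntegral^[q] G t) t := by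
  obtain ⟨p, rfl⟩ := Nat.exists_eq_add_of_le' hq
  rw [Function.iterate_succ']
  exact (hG.iterate_tailIntegral ht₀ q).1.hasDerivAt_tailIntegral ht₀ t

theorem WeightIntegrable.continuous_iterate_tailIntegral (ht₀ : 1 ≤ t₀)
    (hG : WeightIntegrable t₀ r G) : Continuous fun t => c + tailIntegral^[r + 1] G t :=
  continuous_const.add <| continuous_iff_continuousAt.2 fun t =>
    (hG.hasDerivAt_iterate_tailIntegral ht₀ le_rfl t).continuousAt

theorem hasDerivAt_derivChain (ht₀ : 1 ≤ t₀) (hG : WeightIntegrable t₀ r G) {m : ℕ}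
    (hm : m ≤ k + r) (t : ℝ) :
    HasDerivAt (derivChain k r t₀ c a G m) (derivChain k r t₀ c a G (m + 1) t) t := by
  rcases lt_trichotomy m k with h | rfl | h
  · rw [derivChain, derivChain, if_pos h.le, if_pos (by omega),
      show k - m = k - (m + 1) + 1 by omega]
    exact hasDerivAt_headIter (hG.continuous_iterate_tailIntegral ht₀) _ t
  · rw [derivChain, derivChain, if_pos le_rfl, if_neg (by omega), Nat.sub_self,
      show m + r + 1 - (m + 1) = r by omega]
    exact (hG.hasDerivAt_iterate_tailIntegral ht₀ le_rfl t).const_add c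
  · rw [derivChain, derivChain, if_neg (by omega), if_neg (by omega),
      show k + r + 1 - m = k + r + 1 - (m + 1) + 1 by omega]
    exact hG.hasDerivAt_iterate_tailIntegral ht₀ (by omega) t

theorem pow_mul_abs_derivChain_le (ht₀ : 1 ≤ t₀) (hG : WeightIntegrable t₀ r G) {j : ℕ}
    (hj : j ∈ Finset.Icc 1 r) {t : ℝ} (ht : t₀ ≤ t) :
    t ^ j * |derivChain k r t₀ c a G (k + j) t| ≤ ∫ s in Ioi t, s ^ r * |G s| := by
  obtain ⟨hj1, hjr⟩ := Finset.mem_Icc.1 hj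
  obtain ⟨q, rfl⟩ := Nat.exists_eq_add_of_le hjr
  rw [derivChain, if_neg (by omega), show k + (j + q) + 1 - (k + j) = q + 1 by omega]
  exact WeightIntegrable.pow_mul_abs_iterate_tailIntegral_le ht₀ q hG ht

theorem WeightIntegrable.abs_iterate_tailIntegral_le (ht₀ : 1 ≤ t₀) (hG : WeightIntegrable t₀ r G)
    {t : ℝ} (ht : t₀ ≤ t) : |tailIntegral^[r + 1] G t| ≤ ∫ s in Ioi t, s ^ r * |G s| := by
  have h := WeightIntegrable.pow_mul_abs_iterate_tailIntegral_le (p := 0) (w := G) ht₀ r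
    (by rwa [zero_add]) ht
  simpa using h

theorem WeightIntegrable.integral_Ioi_le (ht₀ : 1 ≤ t₀) (hG : WeightIntegrable t₀ r G)
    {t : ℝ} (ht : t₀ ≤ t) :
    ∫ s in Ioi t, s ^ r * |G s| ≤ ∫ s in Ioi t₀, s ^ r * |G s| := by
  refine setIntegral_mono_set (hG.abs ht₀).integrableOn ?_ (Ioi_subset_Ioi ht).eventuallyLE
  refine (ae_restrict_mem measurableSet_Ioi).mono fun s hs => ?_
  exact mul_nonneg (pow_nonneg (by linarith [mem_Ioi.1 hs]) _) (abs_nonneg _)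

theorem abs_derivChain_le (ht₀ : 1 ≤ t₀) (hG : WeightIntegrable t₀ r G) {m : ℕ}
    (hm : m ≤ k + r) {t : ℝ} (ht : t₀ ≤ t) :
    |derivChain k r t₀ c a G m t| ≤
      (|c| + ∑ i ∈ Finset.range k, |a (i + 1)| + ∫ s in Ioi t₀, s ^ r * |G s|) *
        t ^ ((k : ℝ) - m) := by
  have ht0 : 0 < t := by linarith
  have hI := hG.integral_Ioi_le ht₀ ht
  have hS : 0 ≤ ∑ i ∈ Finset.range k, |a (i + 1)| := Finset.sum_nonneg fun _ _ => abs_nonneg _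
  rcases le_or_gt m k with h | h
  · have hexp : t ^ ((k : ℝ) - m) = t ^ (k - m) := by
      rw [← Nat.cast_sub h, rpow_natCast]
    rw [derivChain, if_pos h, hexp]
    refine (abs_headIter_le ht₀ (C := |c| + ∫ s in Ioi t₀, s ^ r * |G s|) (fun s hs => ?_)
      (k - m) ht).trans (mul_le_mul_of_nonneg_right ?_ (by positivity))
    · exact (abs_add_le _ _).trans (add_le_add le_rfl
        ((hG.abs_iterate_tailIntegral_le ht₀ hs).trans (hG.integral_Ioi_le ht₀ hs)))
    · have : ∑ j ∈ Finset.range (k - m), |a (j + 1)| ≤ ∑ j ∈ Finset.range k, |a (j + 1)| :=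
        Finset.sum_le_sum_of_subset_of_nonneg (Finset.range_mono (Nat.sub_le _ _))
          fun _ _ _ => abs_nonneg _
      linarith
  · obtain ⟨j, rfl⟩ := Nat.exists_eq_add_of_le h.le
    have h1 := pow_mul_abs_derivChain_le (k := k) (c := c) (a := a) ht₀ hG
      (Finset.mem_Icc.2 ⟨by omega, by omega⟩ : j ∈ Finset.Icc 1 r) ht
    have hexp : t ^ ((k : ℝ) - (k + j : ℕ)) = (t ^ j)⁻¹ := by
      rw [← rpow_natCast, ← rpow_neg ht0.le]
      congr 1
      push_cast
      ring
    rw [hexp, ← div_eq_mul_inv, le_div_iff₀ (by positivity), mul_comm]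
    linarith [abs_nonneg c]

theorem derivChain_sub (ht₀ : 1 ≤ t₀) (hG : WeightIntegrable t₀ r G)
    (hG' : WeightIntegrable t₀ r G') {m : ℕ} (hm : m ≤ k + r) (t : ℝ) :
    derivChain k r t₀ c a G m t - derivChain k r t₀ c a G' m t =
      derivChain k r t₀ 0 0 (fun s => G s - G' s) m t := by
  have key : ∀ q ≤ r, ∀ t, tailIntegral^[q + 1] (fun s => G s - G' s) t =
      tailIntegral^[q + 1] G t - tailIntegral^[q + 1] G' t := by
    intro q hq t
    obtain ⟨p, rfl⟩ := Nat.exists_eq_add_of_le' hq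
    exact WeightIntegrable.iterate_tailIntegral_sub ht₀ q hG hG' t
  rcases le_or_gt m k with h | h
  · simp only [derivChain, if_pos h]
    rw [headIter_sub (hG.continuous_iterate_tailIntegral ht₀)
      (hG'.continuous_iterate_tailIntegral ht₀)]
    congr 1
    ext s
    rw [key r le_rfl]
    ring
  · obtain ⟨q, hq⟩ : ∃ q, k + r + 1 - m = q + 1 := ⟨k + r - m, by omega⟩
    simp only [derivChain, if_neg (not_le.2 h), hq]
    exact (key q (by omega) t).symm

theorem abs_derivChain_sub_le (ht₀ : 1 ≤ t₀) (hG : WeightIntegrable t₀ r G)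
    (hG' : WeightIntegrable t₀ r G') {m : ℕ} (hm : m ≤ k + r) {t : ℝ} (ht : t₀ ≤ t) :
    |derivChain k r t₀ c a G m t - derivChain k r t₀ c a G' m t| ≤
      (∫ s in Ioi t₀, s ^ r * |G s - G' s|) * t ^ ((k : ℝ) - m) := by
  rw [derivChain_sub ht₀ hG hG' hm]
  simpa using abs_derivChain_le (c := 0) (a := 0) ht₀ (hG.sub hG') hm ht

theorem tendsto_derivChain_self (ht₀ : 1 ≤ t₀) (hG : WeightIntegrable t₀ r G) :
    Tendsto (derivChain k r t₀ c a G k) atTop (𝓝 c) := by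
  have h : Tendsto (tailIntegral^[r + 1] G) atTop (𝓝 0) := by
    refine squeeze_zero_norm' ?_ 
      (tendsto_integral_Ioi_zero (μ := volume) (f := fun s => s ^ r * |G s|) tendsto_id)
    filter_upwards [eventually_ge_atTop t₀] with t ht
    exact hG.abs_iterate_tailIntegral_le ht₀ ht
  rw [derivChain, if_pos le_rfl, Nat.sub_self]
  have h' := h.const_add c
  rwa [add_zero] at h'

theorem tendsto_pow_mul_derivChain (ht₀ : 1 ≤ t₀) (hG : WeightIntegrable t₀ r G) {j : ℕ}
    (hj : j ∈ Finset.Icc 1 r) :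
    Tendsto (fun t => t ^ j * derivChain k r t₀ c a G (k + j) t) atTop (𝓝 0) := by
  refine squeeze_zero_norm' ?_ 
      (tendsto_integral_Ioi_zero (μ := volume) (f := fun s => s ^ r * |G s|) tendsto_id)
  filter_upwards [eventually_ge_atTop t₀] with t ht
  rw [norm_mul, Real.norm_of_nonneg (pow_nonneg (by linarith) _), Real.norm_eq_abs]
  exact pow_mul_abs_derivChain_le ht₀ hG hj ht

end derivChain

theorem WeightIntegrable.of_abs_le {t₀ : ℝ} {p : ℕ} {D G : ℝ → ℝ} (ht₀ : 1 ≤ t₀)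
    (hD : WeightIntegrable t₀ p D) (hG : Continuous G) (h : ∀ t, |G t| ≤ D t) :
    WeightIntegrable t₀ p G := by
  refine ⟨hG, Integrable.mono' hD.integrableOn (by fun_prop) ?_⟩
  refine (ae_restrict_mem measurableSet_Ioi).mono fun s hs => ?_
  have hs0 : 0 ≤ s := by linarith [mem_Ioi.1 hs]
  rw [norm_mul, Real.norm_of_nonneg (by positivity), Real.norm_eq_abs]
  exact mul_le_mul_of_nonneg_left (h s) (by positivity)

theorem WeightIntegrable.integral_abs_le {t₀ : ℝ} {p : ℕ} {D G : ℝ → ℝ} (ht₀ : 1 ≤ t₀)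
    (hD : WeightIntegrable t₀ p D) (hG : Continuous G) (h : ∀ t, |G t| ≤ D t) :
    ∫ s in Ioi t₀, s ^ p * |G s| ≤ ∫ s in Ioi t₀, s ^ p * D s := by
  refine setIntegral_mono_on ((hD.of_abs_le ht₀ hG h).abs ht₀).integrableOn hD.integrableOn
    measurableSet_Ioi fun s hs => ?_
  exact mul_le_mul_of_nonneg_left (h s) (pow_nonneg (by linarith [mem_Ioi.1 hs]) _)

/-- A bounded increment estimate from a bound on the derivative. -/
theorem abs_sub_le_abs_integral {u u' e : ℝ → ℝ} {a b : ℝ} (hu : ∀ x, HasDerivAt u (u' x) x)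
    (hu' : Continuous u') (he : Continuous e) (h : ∀ x ∈ uIoc a b, |u' x| ≤ e x) :
    |u b - u a| ≤ |∫ x in a..b, e x| := by
  rw [← intervalIntegral.integral_eq_sub_of_hasDerivAt (fun x _ => hu x)
    (hu'.intervalIntegrable _ _), ← Real.norm_eq_abs]
  refine intervalIntegral.norm_integral_le_abs_of_norm_le ?_ (he.intervalIntegrable _ _)
  exact (ae_restrict_mem measurableSet_uIoc).mono fun x hx => h x hx

theorem exists_derivChain_eq (k r : ℕ) {t₀ : ℝ} (ht₀ : 1 ≤ t₀) (c : ℝ) (a : ℕ → ℝ)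
    {F : ℝ → (Fin (k + r + 1) → ℝ) → ℝ} {D : ℝ → ℝ}
    (hF : Continuous fun p : ℝ × (Fin (k + r + 1) → ℝ) => F p.1 p.2)
    (hD : WeightIntegrable t₀ r D) (hFD : ∀ t v, |F t v| ≤ D t) :
    ∃ G : ℝ → ℝ, Continuous G ∧ (∀ t, |G t| ≤ D t) ∧
      ∀ t, t₀ ≤ t → G t = F t fun m => derivChain k r t₀ c a G m t := by
  have hGc (v : C(ℝ, Fin (k + r + 1) → ℝ)) : Continuous fun t => F t (v t) :=
    hF.comp (continuous_id.prodMk v.continuous)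
  have hGw (v : C(ℝ, Fin (k + r + 1) → ℝ)) : WeightIntegrable t₀ r fun t => F t (v t) :=
    hD.of_abs_le ht₀ (hGc v) fun t => hFD t _
  have hder (v : C(ℝ, Fin (k + r + 1) → ℝ)) {m : ℕ} (hm : m ≤ k + r) (t : ℝ) :=
    hasDerivAt_derivChain (c := c) (a := a) ht₀ (hGw v) hm t
  have hcont (v : C(ℝ, Fin (k + r + 1) → ℝ)) {m : ℕ} (hm : m ≤ k + r) :
      Continuous (derivChain k r t₀ c a (fun t => F t (v t)) m) :=
    continuous_iff_continuousAt.2 fun t => (hder v hm t).continuousAt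
  have hτ : ∀ t : ℝ, t₀ ≤ max t t₀ := fun t => le_max_right _ _
  have hτ0 : ∀ t : ℝ, 0 < max t t₀ := fun t => by linarith [hτ t]
  have hle (m : Fin (k + r + 1)) : (m : ℕ) ≤ k + r := Nat.lt_succ_iff.1 m.2
  let T : C(ℝ, Fin (k + r + 1) → ℝ) → C(ℝ, Fin (k + r + 1) → ℝ) := fun v =>
    ⟨fun t m => derivChain k r t₀ c a (fun t => F t (v t)) m (max t t₀),
      continuous_pi fun m => (hcont v (hle m)).comp (by fun_prop)⟩
  let β : ℝ := |c| + ∑ i ∈ Finset.range k, |a (i + 1)| + ∫ s in Ioi t₀, s ^ r * D s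
  let B : ℝ → ℝ := fun t => ∑ m ∈ Finset.range (k + r + 1), β * max t t₀ ^ ((k : ℝ) - m)
  let e : ℝ → ℝ := fun t => B t + D t
  have hD0 : ∀ t, 0 ≤ D t := fun t => (abs_nonneg _).trans (hFD t 0)
  have hβ : 0 ≤ β := by
    refine add_nonneg (add_nonneg (abs_nonneg _) (Finset.sum_nonneg fun _ _ => abs_nonneg _)) ?_
    refine setIntegral_nonneg measurableSet_Ioi fun s hs => ?_
    exact mul_nonneg (pow_nonneg (by linarith [mem_Ioi.1 hs]) _) (hD0 s)
  have hterm : ∀ t m, 0 ≤ β * max t t₀ ^ ((k : ℝ) - (m : ℕ)) := fun t m =>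
    mul_nonneg hβ (rpow_nonneg (hτ0 t).le _)
  have hB0 : ∀ t, 0 ≤ B t := fun t => Finset.sum_nonneg fun m _ => hterm t m
  have hBc : Continuous B := by
    refine continuous_finsetSum _ fun m _ => continuous_const.mul ?_
    exact (continuous_id.max continuous_const).rpow_const fun t => Or.inl (hτ0 t).ne'
  have hDc : Continuous D := hD.continuous
  have hec : Continuous e := hBc.add hDc
  have hchain (v : C(ℝ, Fin (k + r + 1) → ℝ)) {m : ℕ} (hm : m ≤ k + r) (t : ℝ) :
      |derivChain k r t₀ c a (fun t => F t (v t)) m (max t t₀)| ≤ B t := by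
    refine (abs_derivChain_le ht₀ (hGw v) hm (hτ t)).trans ?_
    refine (mul_le_mul_of_nonneg_right ?_ (rpow_nonneg (hτ0 t).le _)).trans
      (Finset.single_le_sum (f := fun m : ℕ => β * max t t₀ ^ ((k : ℝ) - m))
        (fun m _ => hterm t m) (Finset.mem_range.2 (Nat.lt_succ_of_le hm)))
    exact add_le_add le_rfl (hD.integral_abs_le ht₀ (hGc v) fun t => hFD t _)
  have hchain' (v : C(ℝ, Fin (k + r + 1) → ℝ)) {m : ℕ} (hm : m ≤ k + r) {t : ℝ} (ht : t₀ ≤ t) :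
      |derivChain k r t₀ c a (fun t => F t (v t)) (m + 1) t| ≤ e t := by
    rcases hm.lt_or_eq with h | rfl
    · have := hchain v (Nat.succ_le_of_lt h) t
      rw [max_eq_left ht] at this
      exact this.trans (le_add_of_nonneg_right (hD0 t))
    · rw [derivChain_last]
      exact (hFD t _).trans (le_add_of_nonneg_left (hB0 t))
  have hchain_cont (v : C(ℝ, Fin (k + r + 1) → ℝ)) {m : ℕ} (hm : m ≤ k + r) :
      Continuous (derivChain k r t₀ c a (fun t => F t (v t)) (m + 1)) := by
    rcases hm.lt_or_eq with h | rfl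
    · exact hcont v h
    · rw [derivChain_last]
      exact hGc v
  have hE : Continuous fun t => ∫ x in t₀..max t t₀, e x :=
    (intervalIntegral.continuous_primitive (fun _ _ => hec.intervalIntegrable _ _) t₀).comp
      (by fun_prop : Continuous fun t => max t t₀)
  obtain ⟨v, hv⟩ := exists_fixedPoint_of_equicontinuous (T := T) (B := B) hE
    (fun v t => (pi_norm_le_iff_of_nonneg (hB0 t)).2 fun m => hchain v (hle m) t)
    (fun v s t => (pi_norm_le_iff_of_nonneg (abs_nonneg _)).2 fun m => by
      rw [intervalIntegral.integral_interval_sub_left (hec.intervalIntegrable _ _)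
        (hec.intervalIntegrable _ _)]
      refine abs_sub_le_abs_integral (hder v (hle m)) (hchain_cont v (hle m)) hec fun x hx => ?_
      refine hchain' v (hle m) ?_
      exact (le_min (hτ t) (hτ s)).trans hx.1.le)
    (fun x v hx t => by
      refine tendsto_pi_nhds.2 fun m => ?_
      have hlim : Tendsto (fun n => ∫ s in Ioi t₀, s ^ r * |F s (x n s) - F s (v s)|) atTop
          (𝓝 (∫ s in Ioi t₀, 0)) := by
        refine tendsto_integral_of_dominated_convergence (fun s => 2 * (s ^ r * D s))
          (fun n => ?_) (hD.integrableOn.const_mul 2) (fun n => ?_) ?_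
        · exact (((hGw (x n)).sub (hGw v)).abs ht₀).integrableOn.aestronglyMeasurable
        · refine (ae_restrict_mem measurableSet_Ioi).mono fun s hs => ?_
          have hs0 : 0 ≤ s := by linarith [mem_Ioi.1 hs]
          rw [norm_mul, Real.norm_of_nonneg (by positivity), norm_abs_eq_norm, Real.norm_eq_abs]
          calc s ^ r * |F s (x n s) - F s (v s)| ≤ s ^ r * (D s + D s) :=
                mul_le_mul_of_nonneg_left
                  ((abs_sub _ _).trans (add_le_add (hFD s _) (hFD s _))) (by positivity)
            _ = _ := by ring
        · refine Eventually.of_forall fun s => ?_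
          have h1 : Tendsto (fun n => F s (x n s)) atTop (𝓝 (F s (v s))) :=
            (hF.comp (Continuous.prodMk_right s)).continuousAt.tendsto.comp (hx s)
          simpa using ((h1.sub_const (F s (v s))).abs).const_mul (s ^ r)
      refine tendsto_iff_norm_sub_tendsto_zero.2 (squeeze_zero (fun _ => norm_nonneg _)
        (fun n => abs_derivChain_sub_le ht₀ (hGw (x n)) (hGw v) (hle m) (hτ t)) ?_)
      simpa using hlim.mul_const (max t t₀ ^ ((k : ℝ) - (m : ℕ))))
  refine ⟨fun t => F t (v t), hGc v, fun t => hFD t _, fun t ht => ?_⟩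
  have hvt : v t = fun m : Fin (k + r + 1) =>
      derivChain k r t₀ c a (fun t => F t (v t)) m t := by
    conv_lhs => rw [← hv]
    ext m
    simp only [T, ContinuousMap.coe_mk, max_eq_left ht]
  exact congrArg (F t) hvt

/-- **Hale–Onuchic, Theorem 2.** For the quasi-linear equation
`u^{(k+r+1)} + Σ_{j=1}^{k+r+1} f_j(t,u,…,u^{(k+r)})·u^{(k+r+1-j)} = 0` with
`|f_j(t,u₀,…,u_{k+r})| ≤ h_j(t)·L_j(|u₀|,…,|u_{k+r}|)`, `L_j` continuous and
nondecreasing on the nonnegative orthant and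
`∫_1^∞ t^{j-1} h_j(t) L_j(β t^k,…,β t^{-r}) dt < ∞` for all `β > 0`, there is a
solution on some `[t₀,∞)` with the prescribed data. The solution is encoded by the
chain `U 0, U 1, …` of its successive derivatives. -/
theorem stmt_4 (k r : ℕ) (hkr : 1 ≤ k + r)
    (f : ℕ → ℝ → (Fin (k + r + 1) → ℝ) → ℝ)
    (hf_cont : ∀ j ∈ Finset.Icc 1 (k + r + 1),
      ContinuousOn (fun p : ℝ × (Fin (k + r + 1) → ℝ) => f j p.1 p.2)
        (Set.Ici (1 : ℝ) ×ˢ Set.univ))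
    (h : ℕ → ℝ → ℝ)
    (hh_cont : ∀ j ∈ Finset.Icc 1 (k + r + 1), ContinuousOn (h j) (Set.Ici (1 : ℝ)))
    (hh_nonneg : ∀ j ∈ Finset.Icc 1 (k + r + 1), ∀ t ∈ Set.Ici (1 : ℝ), 0 ≤ h j t)
    (L : ℕ → (Fin (k + r + 1) → ℝ) → ℝ)
    (hL_cont : ∀ j ∈ Finset.Icc 1 (k + r + 1),
      ContinuousOn (L j) {v : Fin (k + r + 1) → ℝ | ∀ i, 0 ≤ v i})
    (hL_nonneg : ∀ j ∈ Finset.Icc 1 (k + r + 1), ∀ v : Fin (k + r + 1) → ℝ,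
      (∀ i, 0 ≤ v i) → 0 ≤ L j v)
    (hL_mono : ∀ j ∈ Finset.Icc 1 (k + r + 1), ∀ v w : Fin (k + r + 1) → ℝ,
      (∀ i, 0 ≤ v i) → (∀ i, v i ≤ w i) → L j v ≤ L j w)
    (hbound : ∀ j ∈ Finset.Icc 1 (k + r + 1), ∀ t ∈ Set.Ici (1 : ℝ),
      ∀ v : Fin (k + r + 1) → ℝ, |f j t v| ≤ h j t * L j (fun i => |v i|))
    (hint : ∀ β : ℝ, 0 < β → ∀ j ∈ Finset.Icc 1 (k + r + 1),
      IntegrableOn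
        (fun t => t ^ (j - 1) * h j t * L j (fun i => β * t ^ ((k : ℝ) - (i.1 : ℝ))))
        (Set.Ici (1 : ℝ)))
    (c : ℝ) (a : ℕ → ℝ) :
    ∃ t₀ : ℝ, 1 ≤ t₀ ∧ ∃ U : ℕ → ℝ → ℝ,
      (∀ m ≤ k + r, ∀ t ∈ Set.Ici t₀, HasDerivAt (U m) (U (m + 1) t) t) ∧
      (∀ t ∈ Set.Ici t₀,
        U (k + r + 1) t +
          ∑ j ∈ Finset.Icc 1 (k + r + 1),
            f j t (fun i => U i.1 t) * U (k + r + 1 - j) t = 0) ∧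
      (∀ i < k, U i t₀ = a (k - i)) ∧
      Tendsto (U k) atTop (𝓝 c) ∧
      ∀ j ∈ Finset.Icc 1 r, Tendsto (fun t => t ^ j * U (k + j) t) atTop (𝓝 0) := by
  have hβ0 : 0 ≤ |c| + ∑ i ∈ Finset.range k, |a (i + 1)| :=
    add_nonneg (abs_nonneg _) (Finset.sum_nonneg fun _ _ => abs_nonneg _)
  obtain ⟨β, hβ⟩ : ∃ β, β = |c| + ∑ i ∈ Finset.range k, |a (i + 1)| + 1 := ⟨_, rfl⟩
  have hβpos : 0 < β := by rw [hβ]; linarith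
  let b : ℝ → ℕ → ℝ := fun s i => β * s ^ ((k : ℝ) - i)
  have hb0 : ∀ s, 1 ≤ s → ∀ i, 0 ≤ b s i := fun s hs i =>
    mul_nonneg hβpos.le (rpow_nonneg (by linarith) _)
  let d : ℝ → ℝ := fun s =>
    ∑ j ∈ Finset.Icc 1 (k + r + 1), h j s * L j (fun i => b s i) * b s (k + r + 1 - j)
  have hbc : ∀ i, ContinuousOn (fun s => b s i) (Ici 1) := fun i =>
    continuousOn_const.mul (continuousOn_id.rpow_const fun s hs =>
      Or.inl (by linarith [mem_Ici.1 hs] : (0 : ℝ) < s).ne')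
  have hdc : ContinuousOn d (Ici 1) := by
    refine continuousOn_finsetSum _ fun j hj => ?_
    refine ((hh_cont j hj).mul ((hL_cont j hj).comp (continuousOn_pi.2 fun i => hbc i)
      fun s hs i => hb0 s hs i)).mul (hbc _)
  have hdpow : ∀ s ∈ Ici (1 : ℝ), ∑ j ∈ Finset.Icc 1 (k + r + 1),
      β * (s ^ (j - 1) * h j s * L j (fun i => β * s ^ ((k : ℝ) - (i.1 : ℝ)))) = s ^ r * d s := by
    intro s hs
    have hs0 : 0 < s := by linarith [mem_Ici.1 hs]
    rw [Finset.mul_sum]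
    refine Finset.sum_congr rfl fun j hj => ?_
    obtain ⟨hj1, hj2⟩ := Finset.mem_Icc.1 hj
    have hpow : s ^ (j - 1) = s ^ r * s ^ ((k : ℝ) - (k + r + 1 - j : ℕ)) := by
      rw [← rpow_natCast, ← rpow_natCast, ← rpow_add hs0, Nat.cast_sub hj1, Nat.cast_sub hj2]
      congr 1
      push_cast
      ring
    simp only [b]
    rw [hpow]
    ring
  have hdint : IntegrableOn (fun s => s ^ r * d s) (Ici 1) := by
    refine IntegrableOn.congr_fun ?_ hdpow measurableSet_Ici
    exact integrable_finsetSum _ fun j hj => (hint β hβpos j hj).const_mul β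
  obtain ⟨t₀, ht₀, hsmall⟩ : ∃ t₀ : ℝ, 1 ≤ t₀ ∧ ∫ s in Ioi t₀, s ^ r * d s ≤ 1 :=
    ((eventually_ge_atTop 1).and ((tendsto_integral_Ioi_zero (μ := volume)
      (f := fun s => s ^ r * d s) tendsto_id).eventually_le_const one_pos)).exists
  have hτ : ∀ t : ℝ, 1 ≤ max t t₀ := fun t => ht₀.trans (le_max_right _ _)
  have hτc : Continuous fun t : ℝ => max t t₀ := by fun_prop
  have hDeq : ∀ s ∈ Ioi t₀, s ^ r * d s = s ^ r * d (max s t₀) := fun s hs => by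
    rw [max_eq_left (le_of_lt hs)]
  have hD : WeightIntegrable t₀ r fun t => d (max t t₀) :=
    ⟨hdc.comp_continuous hτc hτ, (hdint.mono_set fun s hs =>
      ht₀.trans (le_of_lt hs)).congr_fun hDeq measurableSet_Ioi⟩
  let cl : ℝ → (Fin (k + r + 1) → ℝ) → Fin (k + r + 1) → ℝ := fun t v i =>
    max (-b (max t t₀) i) (min (v i) (b (max t t₀) i))
  have hcl : ∀ t v i, |cl t v i| ≤ b (max t t₀) i := fun t v i =>
    abs_le.2 ⟨le_max_left _ _, max_le (by linarith [hb0 _ (hτ t) i]) (min_le_right _ _)⟩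
  have hclc : Continuous fun p : ℝ × (Fin (k + r + 1) → ℝ) => cl p.1 p.2 := by
    refine continuous_pi fun i => ?_
    have h1 : Continuous fun p : ℝ × (Fin (k + r + 1) → ℝ) => b (max p.1 t₀) i :=
      ((hbc i).comp_continuous hτc hτ).comp continuous_fst
    exact h1.neg.max (((continuous_apply i).comp continuous_snd).min h1)
  let idx : ℕ → Fin (k + r + 1) := fun j => Fin.ofNat (k + r + 1) (k + r + 1 - j)
  have hidx : ∀ j ∈ Finset.Icc 1 (k + r + 1), (idx j : ℕ) = k + r + 1 - j := fun j hj =>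
    Nat.mod_eq_of_lt (by have := Finset.mem_Icc.1 hj; omega)
  let F : ℝ → (Fin (k + r + 1) → ℝ) → ℝ := fun t v =>
    -∑ j ∈ Finset.Icc 1 (k + r + 1), f j (max t t₀) (cl t v) * cl t v (idx j)
  have hF : Continuous fun p : ℝ × (Fin (k + r + 1) → ℝ) => F p.1 p.2 := by
    refine (continuous_finsetSum _ fun j hj => Continuous.mul ?_ ?_).neg
    · exact (hf_cont j hj).comp_continuous ((hτc.comp continuous_fst).prodMk hclc)
        fun p => ⟨hτ p.1, mem_univ _⟩
    · exact (continuous_apply (idx j)).comp hclc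
  have hFD : ∀ t v, |F t v| ≤ d (max t t₀) := by
    intro t v
    rw [abs_neg]
    refine (Finset.abs_sum_le_sum_abs _ _).trans (Finset.sum_le_sum fun j hj => ?_)
    have h1 := hh_nonneg j hj _ (hτ t)
    rw [abs_mul]
    refine mul_le_mul ?_ ?_ (abs_nonneg _)
      (mul_nonneg h1 (hL_nonneg j hj _ fun i => hb0 _ (hτ t) i))
    · exact (hbound j hj _ (hτ t) _).trans (mul_le_mul_of_nonneg_left
        (hL_mono j hj _ _ (fun i => abs_nonneg _) fun i => hcl t v i) h1)
    · rw [← hidx j hj]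
      exact hcl t v _
  obtain ⟨G, hGc, hGD, hG⟩ := exists_derivChain_eq k r ht₀ c a hF hD hFD
  have hGw : WeightIntegrable t₀ r G := hD.of_abs_le ht₀ hGc hGD
  have hI : ∫ s in Ioi t₀, s ^ r * |G s| ≤ 1 :=
    (hD.integral_abs_le ht₀ hGc hGD).trans
      ((setIntegral_congr_fun measurableSet_Ioi hDeq).symm.le.trans hsmall)
  refine ⟨t₀, ht₀, derivChain k r t₀ c a G, fun m hm t _ => hasDerivAt_derivChain ht₀ hGw hm t,
    fun t ht => ?_, fun i hi => derivChain_apply_left hi, tendsto_derivChain_self ht₀ hGw,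
    fun j hj => tendsto_pow_mul_derivChain ht₀ hGw hj⟩
  have hmax : max t t₀ = t := max_eq_left ht
  have hinactive : cl t (fun m => derivChain k r t₀ c a G m t) =
      fun m : Fin (k + r + 1) => derivChain k r t₀ c a G m t := by
    ext m
    have hle : |derivChain k r t₀ c a G m t| ≤ b t m := by
      refine (abs_derivChain_le ht₀ hGw (Nat.lt_succ_iff.1 m.2) ht).trans
        (mul_le_mul_of_nonneg_right ?_ (rpow_nonneg (zero_le_one.trans (ht₀.trans ht)) _))
      rw [hβ]
      linarith
    simp only [cl, hmax]
    rw [min_eq_left (abs_le.1 hle).2, max_eq_right (abs_le.1 hle).1]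
  rw [derivChain_last, hG t ht]
  simp only [F, hinactive, hmax]
  rw [neg_add_eq_zero]
  exact Finset.sum_congr rfl fun j hj => by rw [hidx j hj]
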